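/- Let S be a pseudogroup and let X be a left S-module. Then the poset X (under the order x ≤ y iff x = ey for some e ∈ E(S)) has all binary meets. -/

import Mathlib

namespace PseudogroupMorita

/-- An inverse semigroup: a semigroup in which every element `a` has a unique
inverse `a⁻¹` satisfying `a * a⁻¹ * a = a` and `a⁻¹ * a * a⁻¹ = a⁻¹`. -/
class InverseSemigroup (S : Type*) extends Semigroup S, Inv S where
  mul_inv_mul : ∀ a : S, a * a⁻¹ * a = a
  inv_mul_inv : ∀ a : S, a⁻¹ * a * a⁻¹ = a⁻¹
  inv_unique : ∀ a b : S, a * b * a = a → b * a * b = b → b = a⁻¹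

/-- `a` is an idempotent. -/
def IsIdem {S : Type*} [Mul S] (a : S) : Prop := a * a = a

/-- The natural partial order: `a ≤ b` iff `a = e * b` for some idempotent `e`. -/
def nle {S : Type*} [Mul S] (a b : S) : Prop := ∃ e : S, IsIdem e ∧ a = e * b

/-- `s` and `t` are left compatible: `s⁻¹ * t` is an idempotent. -/
def LeftCompat {S : Type*} [Mul S] [Inv S] (s t : S) : Prop := IsIdem (s⁻¹ * t)

/-- `s` and `t` are right compatible: `s * t⁻¹` is an idempotent. -/
def RightCompat {S : Type*} [Mul S] [Inv S] (s t : S) : Prop := IsIdem (s * t⁻¹)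

/-- `s` and `t` are compatible. -/
def Compat {S : Type*} [Mul S] [Inv S] (s t : S) : Prop := LeftCompat s t ∧ RightCompat s t

/-- A compatible subset: any two of its elements are compatible. -/
def CompatSet {S : Type*} [Mul S] [Inv S] (A : Set S) : Prop := ∀ a ∈ A, ∀ b ∈ A, Compat a b

/-- `j` is the join (least upper bound) of `A` with respect to the natural partial order. -/
def IsJoin {S : Type*} [Mul S] (A : Set S) (j : S) : Prop :=
  (∀ a ∈ A, nle a j) ∧ ∀ b : S, (∀ a ∈ A, nle a b) → nle j b

/-- A pseudogroup: an inverse semigroup in which every compatible subset has a join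
and multiplication distributes over such joins. -/
class Pseudogroup (S : Type*) extends InverseSemigroup S where
  joins_exist : ∀ A : Set S, CompatSet A → ∃ j : S, IsJoin A j
  mul_join_left : ∀ (s : S) (A : Set S) (j : S), CompatSet A → IsJoin A j →
    IsJoin ((fun a => s * a) '' A) (s * j)
  mul_join_right : ∀ (s : S) (A : Set S) (j : S), CompatSet A → IsJoin A j →
    IsJoin ((fun a => a * s) '' A) (j * s)

/-- `A^∨`: the set of all joins of compatible subsets of `A`. -/
def supClosure {S : Type*} [Mul S] [Inv S] (A : Set S) : Set S :=
  {j | ∃ C : Set S, C ⊆ A ∧ CompatSet C ∧ IsJoin C j}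

/-- The underlying set of the local semigroup `eSe`. -/
def locSet {S : Type*} [Mul S] (e : S) : Set S := {u : S | u = e * u * e}

/-- The set `A * B * C` of triple products. -/
def tripleProd {S : Type*} [Mul S] (A B C : Set S) : Set S :=
  {x : S | ∃ a ∈ A, ∃ b ∈ B, ∃ c ∈ C, x = a * b * c}

/-- A (two-sided) semigroup ideal. -/
def SemigroupIdeal {S : Type*} [Mul S] (I : Set S) : Prop :=
  ∀ s : S, ∀ a ∈ I, s * a ∈ I ∧ a * s ∈ I

/-- A sup-ideal: an ideal closed under arbitrary compatible joins. -/
def IsSupIdeal {S : Type*} [Mul S] [Inv S] (I : Set S) : Prop :=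
  SemigroupIdeal I ∧ ∀ C : Set S, C ⊆ I → CompatSet C → ∀ j : S, IsJoin C j → j ∈ I

/-- A pencil from `e` to `f`: a subset `X` with `e = ⋁_{x ∈ X} d x` and `f ≥ ⋁_{x ∈ X} r x`. -/
def IsPencil {S : Type*} [Mul S] [Inv S] (X : Set S) (e f : S) : Prop :=
  IsJoin ((fun x => x⁻¹ * x) '' X) e ∧
  ∃ j : S, IsJoin ((fun x => x * x⁻¹) '' X) j ∧ nle j f

/-- `e ⪯ f` iff there is a pencil from `e` to `f`. -/
def PencilLE {S : Type*} [Mul S] [Inv S] (e f : S) : Prop := ∃ X : Set S, IsPencil X e f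

/-- A sup-ideal of the (local) pseudogroup whose underlying set is `A`. -/
def IsSupIdealIn {S : Type*} [Mul S] [Inv S] (A I : Set S) : Prop :=
  I ⊆ A ∧ (∀ s ∈ A, ∀ a ∈ I, s * a ∈ I ∧ a * s ∈ I) ∧
  ∀ C : Set S, C ⊆ I → CompatSet C → ∀ j : S, IsJoin C j → j ∈ I

/-- The (local) pseudogroup with underlying set `A` and least element `z` is 0-simplifying:
its only sup-ideals are `{z}` and `A` itself. -/
def ZeroSimplifyingIn {S : Type*} [Mul S] [Inv S] (A : Set S) (z : S) : Prop :=
  ∀ I : Set S, IsSupIdealIn A I → I = {z} ∨ I = A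

/-- The (local) inverse semigroup with underlying set `A` is fundamental: any of its
elements commuting with all of its idempotents is an idempotent. -/
def FundamentalIn {S : Type*} [Mul S] (A : Set S) : Prop :=
  ∀ a ∈ A, (∀ g ∈ A, IsIdem g → a * g = g * a) → IsIdem a

/-- A supported left action of an inverse semigroup `S` on a set `X`. -/
structure SupportedAction (S : Type*) [InverseSemigroup S] (X : Type*) where
  act : S → X → X
  act_mul : ∀ (s t : S) (x : X), act (s * t) x = act s (act t x)
  p : X → S
  p_idem : ∀ x : X, IsIdem (p x)
  p_act : ∀ x : X, act (p x) x = x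
  p_conj : ∀ (s : S) (x : X), p (act s x) = s * p x * s⁻¹

namespace SupportedAction

variable {S : Type*} [InverseSemigroup S] {X Y : Type*}

/-- `x` and `y` are left compatible: `p(x) y = p(y) x`. -/
def LCompat (M : SupportedAction S X) (x y : X) : Prop :=
  M.act (M.p x) y = M.act (M.p y) x

/-- A left compatible subset of `X`. -/
def LCompatSet (M : SupportedAction S X) (A : Set X) : Prop :=
  ∀ x ∈ A, ∀ y ∈ A, M.LCompat x y

/-- The order on `X`: `x ≤ y` iff `x = e • y` for some idempotent `e`. -/
def xle (M : SupportedAction S X) (x y : X) : Prop :=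
  ∃ e : S, IsIdem e ∧ x = M.act e y

/-- `j` is the join of `A ⊆ X`. -/
def IsJoinX (M : SupportedAction S X) (A : Set X) (j : X) : Prop :=
  (∀ a ∈ A, M.xle a j) ∧ ∀ b : X, (∀ a ∈ A, M.xle a b) → M.xle j b

/-- `m` is the (binary) meet of `x` and `y` in `X`. -/
def IsMeetX (M : SupportedAction S X) (x y m : X) : Prop :=
  M.xle m x ∧ M.xle m y ∧ ∀ z : X, M.xle z x → M.xle z y → M.xle z m

/-- The action is pointed, with minimum `z ∈ X` and `zS` the least element of `S`:
`s • z = z` and `zS • x = z`. -/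
def Pointed (M : SupportedAction S X) (z : X) (zS : S) : Prop :=
  (∀ x : X, M.xle z x) ∧ (∀ s : S, M.act s z = z) ∧ (∀ x : X, M.act zS x = z)

/-- A homomorphism of supported left `S`-actions. -/
def IsActHom (M : SupportedAction S X) (N : SupportedAction S Y) (θ : X → Y) : Prop :=
  (∀ (s : S) (x : X), θ (M.act s x) = N.act s (θ x)) ∧ ∀ x : X, N.p (θ x) = M.p x

end SupportedAction

/-- A left `S`-module over a pseudogroup `S`: a supported left action such that every
left compatible subset of `X` has a join, the action distributes over left compatible
joins, and joins of compatible subsets of `S` act as joins. -/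
structure SMod (S : Type*) [Pseudogroup S] (X : Type*) extends SupportedAction S X where
  joinsX : ∀ A : Set X, toSupportedAction.LCompatSet A → ∃ j : X, toSupportedAction.IsJoinX A j
  act_joinX : ∀ (s : S) (A : Set X) (j : X), toSupportedAction.LCompatSet A →
    toSupportedAction.IsJoinX A j →
    toSupportedAction.IsJoinX (toSupportedAction.act s '' A) (toSupportedAction.act s j)
  join_act : ∀ (A : Set S) (j : S), CompatSet A → IsJoin A j → ∀ x : X,
    toSupportedAction.IsJoinX ((fun s => toSupportedAction.act s x) '' A)
      (toSupportedAction.act j x)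

/-- A homomorphism of left `S`-modules: a homomorphism of the underlying supported
actions preserving all left compatible joins. -/
def IsModHom {S X Y : Type*} [Pseudogroup S] (M : SMod S X) (N : SMod S Y) (θ : X → Y) : Prop :=
  SupportedAction.IsActHom M.toSupportedAction N.toSupportedAction θ ∧
  ∀ (A : Set X) (j : X), M.toSupportedAction.LCompatSet A → M.toSupportedAction.IsJoinX A j →
    N.toSupportedAction.IsJoinX (θ '' A) (θ j)

/-- `L(X)`: the set of left compatible order-ideals of a supported action `X`. -/
abbrev LIdeal {S : Type*} [InverseSemigroup S] {X : Type*} (M : SupportedAction S X) : Type _ :=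
  {A : Set X // (∀ x y : X, M.xle x y → y ∈ A → x ∈ A) ∧ M.LCompatSet A}

/-- An `(S,T)`-biaction with inner products. -/
structure Biaction (S T : Type*) [InverseSemigroup S] [InverseSemigroup T] (X : Type*) where
  actL : S → X → X
  actL_mul : ∀ (s t : S) (x : X), actL (s * t) x = actL s (actL t x)
  actR : X → T → X
  actR_mul : ∀ (x : X) (t u : T), actR x (t * u) = actR (actR x t) u
  actLR : ∀ (s : S) (x : X) (t : T), actR (actL s x) t = actL s (actR x t)
  ip : X → X → S
  iq : X → X → T
  ip_actL : ∀ (s : S) (x y : X), ip (actL s x) y = s * ip x y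
  ip_symm : ∀ x y : X, ip y x = (ip x y)⁻¹
  ip_self_act : ∀ x : X, actL (ip x x) x = x
  iq_actR : ∀ (x y : X) (t : T), iq x (actR y t) = iq x y * t
  iq_symm : ∀ x y : X, iq y x = (iq x y)⁻¹
  iq_self_act : ∀ x : X, actR x (iq x x) = x
  ip_iq_assoc : ∀ x y z : X, actL (ip x y) z = actR x (iq y z)

namespace Biaction

variable {S T : Type*} [InverseSemigroup S] [InverseSemigroup T] {X : Type*}

/-- Left compatibility in a biaction: `p(x) y = p(y) x` with `p x = ⟨x,x⟩`. -/
def LCompatX (B : Biaction S T X) (x y : X) : Prop :=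
  B.actL (B.ip x x) y = B.actL (B.ip y y) x

/-- Right compatibility in a biaction: `x q(y) = y q(x)` with `q x = [x,x]`. -/
def RCompatX (B : Biaction S T X) (x y : X) : Prop :=
  B.actR x (B.iq y y) = B.actR y (B.iq x x)

/-- Compatibility in a biaction. -/
def CompatX (B : Biaction S T X) (x y : X) : Prop := B.LCompatX x y ∧ B.RCompatX x y

/-- A compatible subset of `X`. -/
def CompatSetX (B : Biaction S T X) (A : Set X) : Prop := ∀ x ∈ A, ∀ y ∈ A, B.CompatX x y

/-- The order on `X`: `x ≤ y` iff `x = e • y` for some idempotent `e ∈ S`. -/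
def bxle (B : Biaction S T X) (x y : X) : Prop := ∃ e : S, IsIdem e ∧ x = B.actL e y

/-- `j` is the join of `A ⊆ X`. -/
def IsJoinBX (B : Biaction S T X) (A : Set X) (j : X) : Prop :=
  (∀ a ∈ A, B.bxle a j) ∧ ∀ b : X, (∀ a ∈ A, B.bxle a b) → B.bxle j b

end Biaction

/-- An `(S,T)`-bimodule over pseudogroups `S` and `T`. -/
structure Bimodule (S T : Type*) [Pseudogroup S] [Pseudogroup T] (X : Type*) extends
    Biaction S T X where
  joinsX : ∀ A : Set X, toBiaction.CompatSetX A → ∃ j : X, toBiaction.IsJoinBX A j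
  distL : ∀ (s : S) (A : Set X) (j : X), toBiaction.CompatSetX A → toBiaction.IsJoinBX A j →
    toBiaction.IsJoinBX (toBiaction.actL s '' A) (toBiaction.actL s j)
  distSL : ∀ (A : Set S) (j : S), CompatSet A → IsJoin A j → ∀ x : X,
    toBiaction.IsJoinBX ((fun s => toBiaction.actL s x) '' A) (toBiaction.actL j x)
  distR : ∀ (t : T) (A : Set X) (j : X), toBiaction.CompatSetX A → toBiaction.IsJoinBX A j →
    toBiaction.IsJoinBX ((fun x => toBiaction.actR x t) '' A) (toBiaction.actR j t)
  distTR : ∀ (A : Set T) (j : T), CompatSet A → IsJoin A j → ∀ x : X,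
    toBiaction.IsJoinBX ((fun t => toBiaction.actR x t) '' A) (toBiaction.actR x j)
  distIP : ∀ (A : Set X) (j : X), toBiaction.CompatSetX A → toBiaction.IsJoinBX A j → ∀ y : X,
    IsJoin ((fun x => toBiaction.ip x y) '' A) (toBiaction.ip j y)
  distIQ : ∀ (A : Set X) (j : X), toBiaction.CompatSetX A → toBiaction.IsJoinBX A j → ∀ y : X,
    IsJoin ((fun x => toBiaction.iq y x) '' A) (toBiaction.iq y j)

/-- An `(S,T)`-equivalence bimodule: an `(S,T)`-bimodule satisfying both covering
conditions `⋁_{x∈X} ⟨x,x⟩ = e_S` and `⋁_{x∈X} [x,x] = e_T`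
(where `e_S = ⋁ E(S)` and `e_T = ⋁ E(T)`). -/
structure EquivBimodule (S T : Type*) [Pseudogroup S] [Pseudogroup T] (X : Type*) extends
    Bimodule S T X where
  coverS : ∀ jS : S, IsJoin {e : S | IsIdem e} jS →
    IsJoin (Set.range fun x : X => toBimodule.toBiaction.ip x x) jS
  coverT : ∀ jT : T, IsJoin {e : T | IsIdem e} jT →
    IsJoin (Set.range fun x : X => toBimodule.toBiaction.iq x x) jT


theorem idem_inv {S : Type*} [InverseSemigroup S] {e : S} (he : IsIdem e) : e⁻¹ = e := by
  have he' : e * e = e := he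
  exact (InverseSemigroup.inv_unique e e (by rw [he', he']) (by rw [he', he'])).symm

theorem idem_mul {S : Type*} [InverseSemigroup S] {e f : S} (he : IsIdem e) (hf : IsIdem f) :
    IsIdem (e * f) := by
  have he' : e * e = e := he
  have hf' : f * f = f := hf
  have hel : ∀ z, e * (e * z) = e * z := fun z => by rw [← mul_assoc, he']
  have hfl : ∀ z, f * (f * z) = f * z := fun z => by rw [← mul_assoc, hf']
  obtain ⟨w, hw⟩ : ∃ w, w = (e * f)⁻¹ := ⟨_, rfl⟩
  have h1 := InverseSemigroup.mul_inv_mul (e * f)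
  have h2 := InverseSemigroup.inv_mul_inv (e * f)
  rw [← hw] at h1 h2
  simp only [mul_assoc] at h1 h2
  have h2l : ∀ z, w * (e * (f * (w * z))) = w * z := fun z => by
    have := congrArg (· * z) h2
    simpa only [mul_assoc] using this
  have h3 : f * w * e = w := by
    rw [hw]
    apply InverseSemigroup.inv_unique
    · rw [← hw]; simp only [mul_assoc, hel, hfl]; exact h1
    · rw [← hw]; simp only [mul_assoc, hel, hfl, h2l]
  have h4 : w * w = w := by
    calc w * w = (f * w * e) * (f * w * e) := by rw [h3]
      _ = f * w * e := by simp only [mul_assoc, h2l]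
      _ = w := h3
  have h5 : e * f = w⁻¹ := by
    apply InverseSemigroup.inv_unique
    · simp only [mul_assoc]; exact h2
    · simp only [mul_assoc]; exact h1
  rw [h5, idem_inv h4]
  exact h4

theorem idem_comm {S : Type*} [InverseSemigroup S] {e f : S} (he : IsIdem e) (hf : IsIdem f) :
    e * f = f * e := by
  have he' : e * e = e := he
  have hf' : f * f = f := hf
  have hel : ∀ z, e * (e * z) = e * z := fun z => by rw [← mul_assoc, he']
  have hfl : ∀ z, f * (f * z) = f * z := fun z => by rw [← mul_assoc, hf']
  have h1 : e * f * (e * f) = e * f := idem_mul he hf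
  have h2 : f * e * (f * e) = f * e := idem_mul hf he
  have h3 : f * e = (e * f)⁻¹ := by
    apply InverseSemigroup.inv_unique
    · simp only [mul_assoc, hel, hfl] at h1 ⊢; exact h1
    · simp only [mul_assoc, hel, hfl] at h2 ⊢; exact h2
  rw [h3, idem_inv (idem_mul he hf)]

/-- A left `S`-module has all binary meets. -/
theorem statement3 {S X : Type*} [Pseudogroup S] (M : SMod S X) (x y : X) :
    ∃ m : X, M.toSupportedAction.IsMeetX x y m := by
  obtain ⟨j, hj1, hj2⟩ := M.joinsX
    {z | M.toSupportedAction.xle z x ∧ M.toSupportedAction.xle z y} (by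
      rintro u ⟨⟨e, he, rfl⟩, -⟩ v ⟨⟨f, hf, rfl⟩, -⟩
      have hp := M.p_idem x
      unfold SupportedAction.LCompat
      rw [M.p_conj, M.p_conj, ← M.act_mul, ← M.act_mul, idem_inv he, idem_inv hf]
      have he' : e * e = e := he
      have hf' : f * f = f := hf
      have key : e * M.p x * e * f = f * M.p x * f * e := by
        calc e * M.p x * e * f = e * e * M.p x * f := by
              rw [mul_assoc e (M.p x) e, idem_comm hp he, ← mul_assoc]
          _ = f * (e * M.p x) := by rw [he', idem_comm (idem_mul he hp) hf]
          _ = f * M.p x * e := by rw [idem_comm he hp, mul_assoc]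
          _ = f * M.p x * f * e := by
              rw [mul_assoc f (M.p x) f, idem_comm hp hf, ← mul_assoc, hf']
      rw [key])
  exact ⟨j, hj2 x fun a ha => ha.1, hj2 y fun a ha => ha.2, fun z h1 h2 => hj1 z ⟨h1, h2⟩⟩

end PseudogroupMorita
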